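/- For every homogeneous P ∈ S(g) of degree d and every homogeneous δ ∈ S(g*) of degree r with r ≤ d, one has ⟨(ι^{d−r}/(d−r)!)·δ, P⟩ = β(δ(∂)P) in U(g), where (ι^{d−r}/(d−r)!)·δ denotes the product in S(g*) ⊗ U(g) of ι^{d−r}/(d−r)! with δ ⊗ 1. -/

import Mathlib

noncomputable section
set_option linter.unusedSectionVars false

variable {K : Type} [Field K] [CharZero K]
variable {m : ℕ}

/-- The pairing of the monomial `b*_{i₁}⋯b*_{i_k}` of `S(g*)` (exponent vector `α`) with the
monomial `b_{j₁}⋯b_{j_l}` of `S(g)` (exponent vector `γ`):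
`⟨φ₁⋯φ_k, x₁⋯x_k⟩ = Σ_{σ ∈ S_k} φ₁(x_{σ(1)})⋯φ_k(x_{σ(k)})`, and `0` if `k ≠ l`. -/
def pairMon (α γ : Fin m →₀ ℕ) : K :=
  if h : (Finsupp.toMultiset α).toList.length = (Finsupp.toMultiset γ).toList.length then
    ∑ σ : Equiv.Perm (Fin (Finsupp.toMultiset α).toList.length),
      ∏ i, (if (Finsupp.toMultiset α).toList.get i
              = (Finsupp.toMultiset γ).toList.get (Fin.cast h (σ i)) then (1 : K) else 0)
  else 0

/-- The pairing of a monomial of `S(g*)` with an arbitrary element of `S(g)`. -/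
def pairFn (α : Fin m →₀ ℕ) (P : MvPolynomial (Fin m) K) : K :=
  ∑ γ ∈ P.support, MvPolynomial.coeff γ P * pairMon α γ

/-- The pairing `⟨·,·⟩ : S(g*) × S(g) → K`, in the coordinates given by a basis of `g` and the
dual basis of `g*` (`X i` stands for `bᵢ*` in the first argument and for `bᵢ` in the second). -/
def pairS (p P : MvPolynomial (Fin m) K) : K :=
  ∑ α ∈ p.support, MvPolynomial.coeff α p * pairFn α P


variable {L : Type} [LieRing L] [LieAlgebra K L]

open scoped TensorProduct

/-- The pairing `S(g*) → (S(g) → K)` as a bundled bilinear map. -/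
def pairLin : MvPolynomial (Fin m) K →ₗ[K] MvPolynomial (Fin m) K →ₗ[K] K :=
  (MvPolynomial.basisMonomials (Fin m) K).constr K fun α =>
    (MvPolynomial.basisMonomials (Fin m) K).constr K fun γ => pairMon (K := K) α γ

/-- The bilinear map `S(g*) → U(g) → (S(g) → U(g))`, `(Π, u) ↦ (P ↦ ⟨Π, P⟩ • u)`. -/
def pairBilU : MvPolynomial (Fin m) K →ₗ[K] UniversalEnvelopingAlgebra K L →ₗ[K]
    (MvPolynomial (Fin m) K →ₗ[K] UniversalEnvelopingAlgebra K L) :=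
  LinearMap.mk₂ K (fun p u => (pairLin (K := K) (m := m) p).smulRight u)
    (fun p p' u => by
      refine LinearMap.ext fun P => ?_
      simp only [LinearMap.smulRight_apply, map_add, LinearMap.add_apply, add_smul])
    (fun c p u => by
      refine LinearMap.ext fun P => ?_
      simp only [LinearMap.smulRight_apply, map_smul, LinearMap.smul_apply, smul_assoc])
    (fun p u u' => by
      refine LinearMap.ext fun P => ?_
      simp only [LinearMap.smulRight_apply, LinearMap.add_apply, smul_add])
    (fun c p u => by
      refine LinearMap.ext fun P => ?_
      simp only [LinearMap.smulRight_apply, LinearMap.smul_apply]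
      rw [smul_comm])

/-- The pairing `(S(g*) ⊗ U(g)) × S(g) → U(g)` obtained by pairing the first tensor factor
against `S(g)`: `⟨Π ⊗ u, P⟩ = ⟨Π, P⟩ • u`. -/
def pairTensor :
    (MvPolynomial (Fin m) K ⊗[K] UniversalEnvelopingAlgebra K L) →ₗ[K]
      (MvPolynomial (Fin m) K →ₗ[K] UniversalEnvelopingAlgebra K L) :=
  TensorProduct.lift (pairBilU (K := K) (m := m) (L := L))

/-- The identity tensor `ι = Σᵢ bᵢ* ⊗ bᵢ`, viewed as an element of `S(g*) ⊗ U(g)`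
(`X i` stands for `bᵢ*`). -/
def iotaTensor (b : Module.Basis (Fin m) K L) :
    MvPolynomial (Fin m) K ⊗[K] UniversalEnvelopingAlgebra K L :=
  ∑ i, MvPolynomial.X i ⊗ₜ[K] UniversalEnvelopingAlgebra.ι K (b i)

/-- Symmetrization of the monomial with exponent vector `α`:
`(1/d!) Σ_{σ ∈ S_d} x_{σ(1)} ⋯ x_{σ(d)}` in `U(g)`. -/
def symmMonomial (b : Module.Basis (Fin m) K L) (α : Fin m →₀ ℕ) : UniversalEnvelopingAlgebra K L :=
  (((Finsupp.toMultiset α).toList.length.factorial : K))⁻¹ •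
    ∑ σ : Equiv.Perm (Fin (Finsupp.toMultiset α).toList.length),
      (List.ofFn fun j =>
        UniversalEnvelopingAlgebra.ι K (b ((Finsupp.toMultiset α).toList.get (σ j)))).prod

/-- The symmetrization map `β : S(g) → U(g)`. -/
def symmetrization (b : Module.Basis (Fin m) K L) (P : MvPolynomial (Fin m) K) :
    UniversalEnvelopingAlgebra K L :=
  ∑ α ∈ P.support, MvPolynomial.coeff α P • symmMonomial b α

/-- The differential operator `∂^α = ∏ᵢ (∂/∂bᵢ)^(α i)` on `S(g)`. -/
def diffOpMon (α : Fin m →₀ ℕ) : Module.End K (MvPolynomial (Fin m) K) :=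
  ((List.finRange m).map fun i =>
    (((MvPolynomial.pderiv i).toLinearMap : Module.End K (MvPolynomial (Fin m) K)) ^ (α i))).prod

/-- The constant-coefficient differential operator `δ(∂)` applied to `P`; each dual basis
vector `bᵢ*` occurring in `δ` is replaced by `∂/∂bᵢ`. -/
def diffOp (δ P : MvPolynomial (Fin m) K) : MvPolynomial (Fin m) K :=
  ∑ α ∈ δ.support, MvPolynomial.coeff α δ • diffOpMon (K := K) α P

/-- The exponent vector of the monomial `X (f 0) ⋯ X (f (n - 1))`. -/
def content {n : ℕ} (f : Fin n → Fin m) : Fin m →₀ ℕ :=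
  ∑ j, Finsupp.single (f j) 1

lemma content_apply {n : ℕ} (f : Fin n → Fin m) (i : Fin m) :
    content f i = Fintype.card {j // f j = i} := by
  simp [content, Finsupp.finsetSum_apply, Finsupp.single_apply, Fintype.card_subtype]

lemma content_comp_perm {n : ℕ} (f : Fin n → Fin m) (σ : Equiv.Perm (Fin n)) :
    content (f ∘ σ) = content f :=
  Equiv.sum_comp σ fun j => Finsupp.single (f j) 1

lemma content_comp_cast {n k : ℕ} (h : n = k) (f : Fin k → Fin m) :
    content (fun j => f (Fin.cast h j)) = content f := by
  subst h
  rfl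

lemma content_cons {n : ℕ} (i : Fin m) (f : Fin n → Fin m) :
    content (Fin.cons i f : Fin (n + 1) → Fin m) = Finsupp.single i 1 + content f := by
  simp [content, Fin.sum_univ_succ]

lemma content_toList_get (α : Fin m →₀ ℕ) :
    content (Finsupp.toMultiset α).toList.get = α := by
  apply Multiset.toFinsupp.symm.injective
  change Finsupp.toMultiset (∑ j, _) = Finsupp.toMultiset α
  simp only [map_sum, Finsupp.toMultiset_single, one_smul]
  refine (congrArg Multiset.sum (Multiset.map_map (fun i : Fin m => ({i} : Multiset (Fin m)))
    (Finsupp.toMultiset α).toList.get Finset.univ.val).symm).trans ?_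
  rw [Multiset.sum_map_singleton, Fin.univ_val_map, List.ofFn_get, Multiset.coe_toList]

lemma exists_perm_of_content_eq {n : ℕ} {f g : Fin n → Fin m} (h : content f = content g) :
    ∃ τ : Equiv.Perm (Fin n), g ∘ τ = f := by
  have e : ∀ i, Nonempty ({j // f j = i} ≃ {j // g j = i}) := fun i => by
    rw [← Fintype.card_eq, ← content_apply, ← content_apply, h]
  exact ⟨Equiv.ofFiberEquiv fun i => (e i).some, funext fun j => Equiv.ofFiberEquiv_map _ j⟩

/-- The number of ways to rearrange a word `g` into a word `f`. -/
lemma card_perm_comp_eq {n : ℕ} (f g : Fin n → Fin m) :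
    (Finset.univ.filter fun σ : Equiv.Perm (Fin n) => g ∘ σ = f).card
      = if content f = content g then ∏ i, (content g i).factorial else 0 := by
  split_ifs with h
  · obtain ⟨τ, rfl⟩ := exists_perm_of_content_eq h
    simp only [content_apply]
    rw [← DomMulAct.stabilizer_card g, Fintype.card_subtype]
    refine Finset.card_equiv (Equiv.mulRight τ⁻¹) fun σ => ?_
    simp only [Finset.mem_filter, Finset.mem_univ, true_and, Equiv.coe_mulRight,
      Equiv.Perm.coe_mul, ← Function.comp_assoc]
    constructor
    · intro hσ
      rw [hσ, Function.comp_assoc, ← Equiv.Perm.coe_mul, mul_inv_cancel, Equiv.Perm.coe_one,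
        Function.comp_id]
    · intro hσ
      conv_rhs => rw [← hσ]
      rw [Function.comp_assoc, ← Equiv.Perm.coe_mul, inv_mul_cancel, Equiv.Perm.coe_one,
        Function.comp_id]
  · rw [Finset.card_eq_zero, Finset.filter_eq_empty_iff]
    rintro σ - rfl
    exact h (content_comp_perm g σ)

lemma pairMon_eq (α γ : Fin m →₀ ℕ) :
    pairMon (K := K) α γ = if α = γ then ((∏ i, (γ i).factorial : ℕ) : K) else 0 := by
  unfold pairMon
  by_cases h : (Finsupp.toMultiset α).toList.length = (Finsupp.toMultiset γ).toList.length
  · rw [dif_pos h]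
    have key := card_perm_comp_eq (Finsupp.toMultiset α).toList.get
      (fun j => (Finsupp.toMultiset γ).toList.get (Fin.cast h j))
    rw [content_comp_cast h, content_toList_get, content_toList_get] at key
    trans ((if α = γ then ∏ i, (γ i).factorial else 0 : ℕ) : K)
    swap
    · simp
    rw [← key, Finset.card_filter, Nat.cast_sum]
    refine Finset.sum_congr rfl fun σ _ => ?_
    rw [Finset.prod_ite_zero]
    simp [funext_iff, eq_comm]
  · rw [dif_neg h, if_neg fun h' => h (by rw [h'])]

lemma pairLin_monomial (α γ : Fin m →₀ ℕ) :
    pairLin (MvPolynomial.monomial α (1 : K)) (MvPolynomial.monomial γ 1) = pairMon α γ := by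
  have h : ∀ α : Fin m →₀ ℕ, MvPolynomial.monomial α (1 : K)
      = MvPolynomial.basisMonomials (Fin m) K α := fun α => by simp
  rw [h, h, pairLin, Module.Basis.constr_basis, Module.Basis.constr_basis]

/-- Multiplication by a variable is adjoint to the corresponding partial derivative. -/
lemma pairLin_mul_X (p P : MvPolynomial (Fin m) K) (i : Fin m) :
    pairLin (p * MvPolynomial.X i) P = pairLin p (MvPolynomial.pderiv i P) := by
  suffices h : pairLin ∘ₗ LinearMap.mulRight K (MvPolynomial.X i) =
      (pairLin (K := K) (m := m)).compl₂ (MvPolynomial.pderiv i).toLinearMap from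
    LinearMap.congr_fun₂ h p P
  refine (MvPolynomial.basisMonomials (Fin m) K).ext fun α =>
    (MvPolynomial.basisMonomials (Fin m) K).ext fun γ => ?_
  simp only [MvPolynomial.coe_basisMonomials, LinearMap.comp_apply, LinearMap.mulRight_apply,
    LinearMap.compl₂_apply, Derivation.coeFn_coe, MvPolynomial.pderiv_monomial, one_mul]
  rw [MvPolynomial.X, MvPolynomial.monomial_mul, mul_one, pairLin_monomial,
    ← mul_one ((γ i : ℕ) : K), ← smul_eq_mul, ← MvPolynomial.smul_monomial, map_smul, pairLin_monomial,
    pairMon_eq, pairMon_eq, smul_eq_mul]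
  by_cases hi : γ i = 0
  · rw [hi, Nat.cast_zero, zero_mul, if_neg]
    rintro rfl
    simp at hi
  · have hγ : γ - Finsupp.single i 1 + Finsupp.single i 1 = γ :=
      tsub_add_cancel_of_le (by simpa [Finsupp.single_le_iff] using Nat.one_le_iff_ne_zero.2 hi)
    generalize γ - Finsupp.single i 1 = γ' at hγ
    subst hγ
    simp only [add_left_inj]
    split_ifs
    · rw [← Nat.cast_mul]
      congr 1
      rw [← Finset.mul_prod_erase _ _ (Finset.mem_univ i),
        ← Finset.mul_prod_erase _ (fun j => (γ' j).factorial) (Finset.mem_univ i), ← mul_assoc]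
      congr 1
      · simp [Nat.factorial_succ]
      · refine Finset.prod_congr rfl fun j hj => ?_
        simp [(Finset.ne_of_mem_erase hj).symm]
    · simp

lemma pairLin_mul_X_pow (p P : MvPolynomial (Fin m) K) (i : Fin m) (k : ℕ) :
    pairLin (p * MvPolynomial.X i ^ k) P
      = pairLin p (((MvPolynomial.pderiv i).toLinearMap :
          Module.End K (MvPolynomial (Fin m) K)) ^ k <| P) := by
  induction k generalizing P with
  | zero => simp
  | succ k ih =>
    rw [pow_succ, ← mul_assoc, pairLin_mul_X, ih, pow_succ, Module.End.mul_apply]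
    rfl

lemma pairLin_mul_monomial (p P : MvPolynomial (Fin m) K) (α : Fin m →₀ ℕ) :
    pairLin (p * MvPolynomial.monomial α 1) P = pairLin p (diffOpMon α P) := by
  have key : ∀ l : List (Fin m), ∀ p : MvPolynomial (Fin m) K,
      pairLin (p * (l.map fun i => MvPolynomial.X i ^ α i).prod) P
        = pairLin p ((l.map fun i => ((MvPolynomial.pderiv i).toLinearMap :
            Module.End K (MvPolynomial (Fin m) K)) ^ α i).prod P) := by
    intro l
    induction l with
    | nil => simp
    | cons i l ih =>
      intro p
      rw [List.map_cons, List.prod_cons, ← mul_assoc, ih, pairLin_mul_X_pow, List.map_cons,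
        List.prod_cons, Module.End.mul_apply]
  rw [diffOpMon, ← key, MvPolynomial.monomial_eq, MvPolynomial.C_1, one_mul,
    Finsupp.prod_fintype _ _ fun i => pow_zero _, ← List.prod_ofFn, List.ofFn_eq_map]

/-- Multiplication by `q` is adjoint to the differential operator `q(∂)`. -/
lemma pairLin_mul (p q P : MvPolynomial (Fin m) K) :
    pairLin (p * q) P = pairLin p (diffOp q P) := by
  conv_lhs => rw [q.as_sum]
  rw [Finset.mul_sum, map_sum, LinearMap.sum_apply, diffOp, map_sum]
  refine Finset.sum_congr rfl fun α _ => ?_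
  have h : MvPolynomial.monomial α (MvPolynomial.coeff α q)
      = MvPolynomial.coeff α q • MvPolynomial.monomial α 1 := by
    rw [MvPolynomial.smul_monomial, smul_eq_mul, mul_one]
  rw [h, mul_smul_comm, map_smul, map_smul, LinearMap.smul_apply, pairLin_mul_monomial]

lemma pairTensor_tmul (p P : MvPolynomial (Fin m) K) (u : UniversalEnvelopingAlgebra K L) :
    pairTensor (p ⊗ₜ[K] u) P = pairLin p P • u := by
  simp [pairTensor, pairBilU]

lemma pairTensor_mul_tmul_one (t : MvPolynomial (Fin m) K ⊗[K] UniversalEnvelopingAlgebra K L)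
    (q P : MvPolynomial (Fin m) K) :
    pairTensor (t * q ⊗ₜ[K] 1) P = pairTensor t (diffOp q P) := by
  induction t with
  | zero => simp
  | add x y hx hy => rw [add_mul, map_add, LinearMap.add_apply, hx, hy, map_add,
      LinearMap.add_apply]
  | tmul p u =>
    rw [Algebra.TensorProduct.tmul_mul_tmul, mul_one, pairTensor_tmul, pairTensor_tmul,
      pairLin_mul]

lemma isHomogeneous_diffOpMon {P : MvPolynomial (Fin m) K} {d : ℕ} (hP : P.IsHomogeneous d)
    (α : Fin m →₀ ℕ) : (diffOpMon α P).IsHomogeneous (d - α.degree) := by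
  have hpow : ∀ (i : Fin m) (k d : ℕ) (P : MvPolynomial (Fin m) K), P.IsHomogeneous d →
      (((MvPolynomial.pderiv i).toLinearMap : Module.End K (MvPolynomial (Fin m) K)) ^ k <|
        P).IsHomogeneous (d - k) := by
    intro i k
    induction k with
    | zero => simp
    | succ k ih =>
      intro d P hP
      rw [pow_succ, Module.End.mul_apply, add_comm, ← Nat.sub_sub]
      exact ih _ _ hP.pderiv
  have key : ∀ l : List (Fin m), ((l.map fun i => ((MvPolynomial.pderiv i).toLinearMap :
      Module.End K (MvPolynomial (Fin m) K)) ^ α i).prod P).IsHomogeneous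
        (d - (l.map α).sum) := by
    intro l
    induction l with
    | nil => simpa using hP
    | cons i l ih =>
      rw [List.map_cons, List.prod_cons, Module.End.mul_apply, List.map_cons, List.sum_cons,
        add_comm, ← Nat.sub_sub]
      exact hpow _ _ _ _ ih
  have hdeg : α.degree = ((List.finRange m).map α).sum := by
    rw [Finsupp.degree_eq_sum, ← List.sum_ofFn, List.ofFn_eq_map]
  rw [hdeg]
  exact key _

lemma isHomogeneous_diffOp {P q : MvPolynomial (Fin m) K} {d r : ℕ} (hP : P.IsHomogeneous d)
    (hq : q.IsHomogeneous r) : (diffOp q P).IsHomogeneous (d - r) := by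
  refine MvPolynomial.IsHomogeneous.sum _ _ _ fun α hα => ?_
  have hdeg : α.degree = r := by
    by_contra h
    exact (MvPolynomial.mem_support_iff.1 hα) (hq.coeff_eq_zero h)
  rw [MvPolynomial.smul_eq_C_mul, ← hdeg]
  exact (isHomogeneous_diffOpMon hP α).C_mul _

lemma iotaTensor_pow (b : Module.Basis (Fin m) K L) (n : ℕ) :
    iotaTensor b ^ n = ∑ f : Fin n → Fin m, MvPolynomial.monomial (content f) (1 : K) ⊗ₜ[K]
      (List.ofFn fun j => UniversalEnvelopingAlgebra.ι K (b (f j))).prod := by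
  induction n with
  | zero => simp [content, Algebra.TensorProduct.one_def]
  | succ n ih =>
    rw [pow_succ', ih, iotaTensor, Finset.sum_mul_sum, ← Fintype.sum_prod_type',
      ← (Fin.consEquiv fun _ : Fin (n + 1) => Fin m).sum_comp]
    refine Finset.sum_congr rfl fun x _ => ?_
    change _ = MvPolynomial.monomial (content (Fin.cons x.1 x.2 : Fin (n + 1) → Fin m)) (1 : K)
      ⊗ₜ[K] (List.ofFn fun j => UniversalEnvelopingAlgebra.ι K
        (b ((Fin.cons x.1 x.2 : Fin (n + 1) → Fin m) j))).prod
    rw [Algebra.TensorProduct.tmul_mul_tmul, MvPolynomial.X, MvPolynomial.monomial_mul, one_mul,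
      content_cons, List.ofFn_succ, List.prod_cons]
    simp

/-- `⟨ιⁿ/n!, ·⟩` computes the symmetrization of monomials of degree `n`. -/
lemma pairTensor_iotaTensor_pow_monomial (b : Module.Basis (Fin m) K L) (γ : Fin m →₀ ℕ) {n : ℕ}
    (hn : (Finsupp.toMultiset γ).toList.length = n) :
    ((n.factorial : K))⁻¹ • pairTensor (iotaTensor b ^ n) (MvPolynomial.monomial γ 1)
      = symmMonomial b γ := by
  subst hn
  rw [symmMonomial, iotaTensor_pow, map_sum, LinearMap.sum_apply]
  congr 1
  simp only [pairTensor_tmul, pairLin_monomial]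
  rw [← Finset.sum_fiberwise Finset.univ
    fun σ : Equiv.Perm (Fin (Finsupp.toMultiset γ).toList.length) =>
      (Finsupp.toMultiset γ).toList.get ∘ σ]
  refine Finset.sum_congr rfl fun f _ => ?_
  have key := card_perm_comp_eq f (Finsupp.toMultiset γ).toList.get
  rw [content_toList_get] at key
  rw [Finset.sum_congr rfl (g := fun _ =>
    (List.ofFn fun j => UniversalEnvelopingAlgebra.ι K (b (f j))).prod), Finset.sum_const, key,
    pairMon_eq, ← Nat.cast_smul_eq_nsmul K]
  · split_ifs <;> simp
  · intro σ hσ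
    rw [← (Finset.mem_filter.1 hσ).2]
    rfl

lemma pairTensor_iotaTensor_pow (b : Module.Basis (Fin m) K L) {Q : MvPolynomial (Fin m) K} {n : ℕ}
    (hQ : Q.IsHomogeneous n) :
    ((n.factorial : K))⁻¹ • pairTensor (iotaTensor b ^ n) Q = symmetrization b Q := by
  conv_lhs => rw [Q.as_sum]
  rw [map_sum, Finset.smul_sum, symmetrization]
  refine Finset.sum_congr rfl fun γ hγ => ?_
  have hdeg : (Finsupp.toMultiset γ).toList.length = n := by
    rw [Multiset.length_toList, Finsupp.card_toMultiset]
    by_contra h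
    exact (MvPolynomial.mem_support_iff.1 hγ) (hQ.coeff_eq_zero h)
  rw [← mul_one (MvPolynomial.coeff γ Q), ← smul_eq_mul, ← MvPolynomial.smul_monomial, map_smul,
    smul_comm, pairTensor_iotaTensor_pow_monomial b γ hdeg, smul_eq_mul, mul_one]

/-- For homogeneous `P ∈ S(g)` of degree `d` and homogeneous `δ ∈ S(g*)` of degree `r ≤ d`,
`⟨(ι^{d−r}/(d−r)!)·δ, P⟩ = β(δ(∂)P)` in `U(g)`, where the product is taken in the algebra
`S(g*) ⊗ U(g)` and `δ` is included as `δ ⊗ 1`. -/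
theorem pairing_iota_pow_mul_delta (b : Module.Basis (Fin m) K L)
    (P δ : MvPolynomial (Fin m) K) (d r : ℕ) (hrd : r ≤ d)
    (hP : P.IsHomogeneous d) (hδ : δ.IsHomogeneous r) :
    pairTensor ((((d - r).factorial : K))⁻¹ •
        (iotaTensor b ^ (d - r) * (δ ⊗ₜ[K] (1 : UniversalEnvelopingAlgebra K L)))) P
      = symmetrization b (diffOp δ P) := by
  rw [map_smul, LinearMap.smul_apply, pairTensor_mul_tmul_one]
  exact pairTensor_iotaTensor_pow b (isHomogeneous_diffOp hP hδ)

end
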